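/- arXiv:2104.11429 — 2 statements merged into one kernel-verified Lean document; each statement's English description precedes it below -/
import Mathlib

section
/- Suppose M is spherically symmetric about p. Fix θ ∈ S_pM, let η be a unit-speed great-circle arc in S_pM with η(0) = u_0 and η(τ) = θ for some τ ≤ π, and define α(t) = √(λ²−1) ∫₀ᵗ G(ℓ+s)^{-1} ds and γ(t) = (ℓ + t, η(α(t))) in polar coordinates. Then γ(0) = q, γ has constant speed λ, and d(γ(t),p) = ℓ + t for every t ≥ 0; hence for any growth competition {A_t, B_t} between p and q, γ(t) ∉ B_t for all t, i.e. γ is a path avoiding B. Moreover, if ∫₁^∞ dr/G(r) = ∞, then α(t) → ∞ as t → ∞, so there exists T with α(T) = τ, at which time γ(T) = (ℓ+T, θ) lies on the geodesic ray from p in direction θ. -/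
/-!
Formalization framework for "growth competitions" (after the paper's
Section 2), at the metric-space level.

Since Mathlib does not yet have Riemannian metrics, a complete Riemannian
manifold is represented by a proper (hence complete; Hopf-Rinow) metric
space whose distance is the induced length (intrinsic) metric, and
spherical symmetry about `p` with warping function `G` is expressed through
global geodesic polar normal coordinates `Φ : ℝⁿ ≃ M` with `Φ 0 = p` and
`dist (Φ x) p = ‖x‖`, in which the Riemannian distance is the infimum of
lengths of Lipschitz curves measured in the warped metric
`g = dr² + G(r)² dθ²`.
-/

open Set Metric Filter MeasureTheory InnerProductGeometry NNReal ENNReal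
open scoped RealInnerProductSpace Classical

noncomputable section

namespace GrowthComp

variable {M : Type*} [MetricSpace M]

/-- Length of the path `γ : ℝ → M` over the time interval `[0, T]`
(the total variation of `γ` on `[0, T]`, valued in `ℝ≥0∞`). -/
def pathLength (γ : ℝ → M) (T : ℝ) : ℝ≥0∞ := eVariationOn γ (Set.Icc 0 T)

/-- The intrinsic metric `d_S` of `M ∖ S`: the infimum of lengths of Lipschitz
paths from `x` to `y` avoiding `S` (with `sInf ∅ = ∞`). -/
def dCompl (S : Set M) (x y : M) : ℝ≥0∞ :=
  sInf {L : ℝ≥0∞ | ∃ (T : ℝ) (γ : ℝ → M), 0 ≤ T ∧ γ 0 = x ∧ γ T = y ∧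
    (∃ K : ℝ≥0, LipschitzOnWith K γ (Set.Icc 0 T)) ∧
    (∀ t ∈ Set.Icc 0 T, γ t ∉ S) ∧ L = pathLength γ T}

/-- The distance of `M` is the induced length metric (true for every
complete Riemannian manifold). -/
def IsLengthSpace (M : Type*) [MetricSpace M] : Prop :=
  ∀ x y : M, ENNReal.ofReal (dist x y) = dCompl (∅ : Set M) x y

/-- A path `γ : [0, T] → M` *avoids* the (time-indexed) family `B`:
it starts at `q`, is `λ`-Lipschitz, and `γ s ∉ B s` for all `s ∈ [0, T]`. -/
def AvoidsB (q : M) (lam : ℝ) (B : ℝ → Set M) (T : ℝ) (γ : ℝ → M) : Prop :=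
  γ 0 = q ∧ LipschitzOnWith (Real.toNNReal lam) γ (Set.Icc 0 T) ∧
    ∀ s ∈ Set.Icc 0 T, γ s ∉ B s

/-- A path `η : [0, T] → M` *avoids* the family `A`:
it starts at `p`, is `1`-Lipschitz, and `η s ∉ A s` for all `s ∈ [0, T]`. -/
def AvoidsA (p : M) (A : ℝ → Set M) (T : ℝ) (η : ℝ → M) : Prop :=
  η 0 = p ∧ LipschitzOnWith 1 η (Set.Icc 0 T) ∧ ∀ s ∈ Set.Icc 0 T, η s ∉ A s

/-- `{A_t, B_t}_{t ≥ 0}` is a *growth competition* between `p` and `q` with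
speed ratio `λ`: both families are increasing, `A 0 = {q}`, `B 0 = {p}`, and
for `t > 0`, `A t` is the union of `γ([0,t])` over paths `γ` avoiding `B`
and `B t` is the union of `η([0,t))` over paths `η` avoiding `A`. -/
structure IsGrowthCompetition (p q : M) (lam : ℝ) (A B : ℝ → Set M) : Prop where
  monoA : ∀ ⦃t₁ t₂ : ℝ⦄, 0 ≤ t₁ → t₁ ≤ t₂ → A t₁ ⊆ A t₂
  monoB : ∀ ⦃t₁ t₂ : ℝ⦄, 0 ≤ t₁ → t₁ ≤ t₂ → B t₁ ⊆ B t₂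
  A_zero : A 0 = {q}
  B_zero : B 0 = {p}
  A_eq : ∀ t : ℝ, 0 < t →
    A t = {x | ∃ γ : ℝ → M, AvoidsB q lam B t γ ∧ x ∈ γ '' Set.Icc 0 t}
  B_eq : ∀ t : ℝ, 0 < t →
    B t = {x | ∃ η : ℝ → M, AvoidsA p A t η ∧ x ∈ η '' Set.Ico 0 t}

/-- `A_∞ = ⋃_{t ≥ 0} A_t`. -/
def Ainfty (A : ℝ → Set M) : Set M := ⋃ t ∈ Set.Ici (0 : ℝ), A t

/-- `B_∞ = ⋃_{t ≥ 0} B_t`. -/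
def Binfty (B : ℝ → Set M) : Set M := ⋃ t ∈ Set.Ici (0 : ℝ), B t

/-- The recursively defined sets `Ω_n`:
`Ω_0 = ∅`, `Ω_{n+1} = Ω_n ∪ {x ∈ M ∖ Ω_n | d_{Ω_n}(x, q) > λ d(x, p)}`. -/
def OmegaSeq (p q : M) (lam : ℝ) : ℕ → Set M
  | 0 => ∅
  | n + 1 => OmegaSeq p q lam n ∪
      {x | x ∉ OmegaSeq p q lam n ∧
        ENNReal.ofReal (lam * dist x p) < dCompl (OmegaSeq p q lam n) x q}

/-- `Ω = ⋃_{n ≥ 1} Ω_n`. -/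
def Omega (p q : M) (lam : ℝ) : Set M := ⋃ n : ℕ, OmegaSeq p q lam (n + 1)

/-- `γ` is a unit-speed minimizing geodesic from `x` to `y`, parametrized on
`[0, dist x y]`. -/
def IsMinGeodesicFromTo (γ : ℝ → M) (x y : M) : Prop :=
  γ 0 = x ∧ γ (dist x y) = y ∧
    ∀ s ∈ Set.Icc (0 : ℝ) (dist x y), ∀ t ∈ Set.Icc (0 : ℝ) (dist x y),
      dist (γ s) (γ t) = |s - t|

/-- `S` is star-shaped about `p`: every minimizing geodesic from `p` to a
point of `S` lies inside `S`. -/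
def StarShapedAbout (p : M) (S : Set M) : Prop :=
  ∀ x ∈ S, ∀ γ : ℝ → M, IsMinGeodesicFromTo γ p x →
    ∀ t ∈ Set.Icc (0 : ℝ) (dist p x), γ t ∈ S

/-- `x` is *visible* from `q` through the obstacle `S`: no minimizing
geodesic joining `q` and `x` intersects `S`.  (On a nonpositively curved
simply connected manifold minimizing geodesics are unique, so this matches
"the minimizing geodesic joining `q` and `x` does not intersect `S`".) -/
def VisibleThrough (S : Set M) (q x : M) : Prop :=
  ∀ γ : ℝ → M, IsMinGeodesicFromTo γ q x →
    ∀ t ∈ Set.Icc (0 : ℝ) (dist q x), γ t ∉ S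

/-! ### Spherically symmetric manifolds, via polar normal coordinates -/

/-- Euclidean `n`-space, the model space for polar normal coordinates. -/
abbrev Euc (n : ℕ) : Type := EuclideanSpace ℝ (Fin n)

/-- The norm of the tangent vector `v` at the point `x ∈ ℝⁿ ∖ {0}` in the
spherically symmetric (warped product) metric `g = dr² + G(r)² dθ²`:
`g_x(v,v) = ⟨v, x̂⟩² + (G(‖x‖)²/‖x‖²) (‖v‖² − ⟨v, x̂⟩²)`. -/
def warpNorm {n : ℕ} (G : ℝ → ℝ) (x v : Euc n) : ℝ :=
  if x = 0 then ‖v‖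
  else Real.sqrt (⟪v, ‖x‖⁻¹ • x⟫ ^ 2 +
    (G ‖x‖ / ‖x‖) ^ 2 * (‖v‖ ^ 2 - ⟪v, ‖x‖⁻¹ • x⟫ ^ 2))

/-- The length of a (Lipschitz, hence a.e. differentiable) curve `c` on
`[0, T]` in the warped metric `dr² + G(r)² dθ²`. -/
def warpLength {n : ℕ} (G : ℝ → ℝ) (c : ℝ → Euc n) (T : ℝ) : ℝ≥0∞ :=
  ∫⁻ t in Set.Icc (0 : ℝ) T, ENNReal.ofReal (warpNorm G (c t) (deriv c t))

/-- `G` is an admissible warping function: positive and smooth on `(0,∞)`,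
with `G(r) → 0` and `G(r)/r → 1` as `r → 0⁺`. -/
def IsWarping (G : ℝ → ℝ) : Prop :=
  (∀ r : ℝ, 0 < r → 0 < G r) ∧ ContDiffOn ℝ (⊤ : ℕ∞) G (Set.Ioi 0) ∧
    Tendsto G (nhdsWithin 0 (Set.Ioi 0)) (nhds 0) ∧
    Tendsto (fun r => G r / r) (nhdsWithin 0 (Set.Ioi 0)) (nhds 1)

/-- `Φ : ℝⁿ ≃ M` realizes `M` as spherically symmetric about `p` with
warping function `G`: `Φ` is a global geodesic polar normal coordinate
chart — `Φ 0 = p` and the radial coordinate is the distance to `p` — and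
the Riemannian distance of `M` is the infimum of warped lengths of
Lipschitz curves computed in the chart. -/
def IsSphericallySymmetric {n : ℕ} (p : M) (G : ℝ → ℝ) (Φ : Euc n ≃ M) : Prop :=
  IsWarping G ∧ Φ 0 = p ∧ (∀ x : Euc n, dist (Φ x) p = ‖x‖) ∧
    ∀ x y : Euc n, ENNReal.ofReal (dist (Φ x) (Φ y)) =
      sInf {L : ℝ≥0∞ | ∃ (T : ℝ) (c : ℝ → Euc n), 0 ≤ T ∧ c 0 = x ∧ c T = y ∧
        (∃ K : ℝ≥0, LipschitzOnWith K c (Set.Icc 0 T)) ∧ L = warpLength G c T}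

/-- The angular polar coordinate `θ(x) ∈ S_pM ≅ S^{n-1}` of a point
`x ≠ p`, read off through the polar chart `Φ`. -/
def polarTheta {n : ℕ} {M : Type*} [MetricSpace M] (Φ : Euc n ≃ M) (x : M) : Euc n :=
  ‖Φ.symm x‖⁻¹ • Φ.symm x

/-- Nonpositive sectional curvature for the spherically symmetric metric
`dr² + G(r)² dθ²`: the radial sectional curvature is `−G''/G ≤ 0`,
i.e. `G` is convex, and the tangential one is `(1 − G'²)/G² ≤ 0`,
i.e. `G' ≥ 1`. -/
def NonposCurvWarping (G : ℝ → ℝ) : Prop :=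
  ConvexOn ℝ (Set.Ioi 0) G ∧ ∀ r : ℝ, 0 < r → 1 ≤ deriv G r

/-- `∫₁^∞ dr / G(r) = ∞`.  For a surface of revolution this is, by a theorem
of Milnor cited in the paper, equivalent to parabolicity, i.e. conformal
equivalence to the Euclidean plane. -/
def ParabolicWarping (G : ℝ → ℝ) : Prop :=
  ∫⁻ r in Set.Ici (1 : ℝ), ENNReal.ofReal ((G r)⁻¹) = ⊤

/-- `∫₁^∞ dr / G(r) < ∞`.  For a surface of revolution this is, by a theorem
of Milnor cited in the paper, equivalent to hyperbolicity, i.e. conformal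
equivalence to the hyperbolic plane. -/
def HyperbolicWarping (G : ℝ → ℝ) : Prop :=
  ∫⁻ r in Set.Ici (1 : ℝ), ENNReal.ofReal ((G r)⁻¹) < ⊤

lemma abs_calibration_le_warpNorm {n : ℕ} {G : ℝ → ℝ} {a b m : ℝ} {x v e : Euc n}
    (hab : a ^ 2 + b ^ 2 ≤ 1) (he : ‖e‖ ≤ 1) (hx : x ≠ 0) (hm : 0 ≤ m) (hmG : m ≤ G ‖x‖) :
    |a * ⟪v, ‖x‖⁻¹ • x⟫ +
      b * m * (‖x‖⁻¹ * (⟪v, e⟫ - ⟪‖x‖⁻¹ • x, e⟫ * ⟪v, ‖x‖⁻¹ • x⟫))| ≤ warpNorm G x v := by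
  have hr : 0 < ‖x‖ := norm_pos_iff.2 hx
  rw [warpNorm, if_neg hx]
  apply Real.abs_le_sqrt
  set u := ‖x‖⁻¹ • x with hu
  have hu1 : ‖u‖ = 1 := by rw [hu, norm_smul, norm_inv, norm_norm, inv_mul_cancel₀ hr.ne']
  set P := ⟪v, u⟫ with hP
  have hz : ⟪v, e⟫ - ⟪u, e⟫ * P = ⟪v - P • u, e⟫ := by
    rw [inner_sub_left v, real_inner_smul_left u, mul_comm]
  have hperp : ‖v - P • u‖ ^ 2 = ‖v‖ ^ 2 - P ^ 2 := by
    rw [norm_sub_sq_real, real_inner_smul_right, norm_smul, hu1, ← hP, mul_one, Real.norm_eq_abs,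
      sq_abs]
    ring
  have hz2 : (⟪v, e⟫ - ⟪u, e⟫ * P) ^ 2 ≤ ‖v‖ ^ 2 - P ^ 2 := by
    rw [hz, ← hperp]
    have h := abs_real_inner_le_norm (v - P • u) e
    refine sq_le_sq' (abs_le.1 (h.trans ?_)).1 (abs_le.1 (h.trans ?_)).2 <;>
    exact mul_le_of_le_one_right (norm_nonneg _) he
  set Z := ⟪v, e⟫ - ⟪u, e⟫ * P
  have hk : (m * ‖x‖⁻¹) ^ 2 ≤ (G ‖x‖ / ‖x‖) ^ 2 := by
    rw [div_eq_mul_inv]; gcongr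
  have h1 : (m * ‖x‖⁻¹) ^ 2 * Z ^ 2 ≤ (G ‖x‖ / ‖x‖) ^ 2 * (‖v‖ ^ 2 - P ^ 2) := by
    gcongr
  set K := m * ‖x‖⁻¹
  calc (a * P + b * m * (‖x‖⁻¹ * Z)) ^ 2 = (a * P + b * (K * Z)) ^ 2 := by ring
    _ ≤ (a ^ 2 + b ^ 2) * (P ^ 2 + (K * Z) ^ 2) := by nlinarith [sq_nonneg (a * (K * Z) - b * P)]
    _ ≤ 1 * (P ^ 2 + (K * Z) ^ 2) := by gcongr
    _ ≤ _ := by rw [mul_pow]; linarith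

/-- A calibrating function for spiral paths: an infinitesimal contraction for the warped metric
wherever the warping function is at least `m`. -/
def spiralCalibration {n : ℕ} (a b m : ℝ) (e x : Euc n) : ℝ :=
  a * ‖x‖ + b * m * (⟪x, e⟫ * ‖x‖⁻¹)

lemma hasDerivAt_spiralCalibration_comp {n : ℕ} {a b m : ℝ} {e v : Euc n} {c : ℝ → Euc n} {t : ℝ}
    (hc : HasDerivAt c v t) (h0 : c t ≠ 0) :
    HasDerivAt (fun s => spiralCalibration a b m e (c s))
      (a * ⟪v, ‖c t‖⁻¹ • c t⟫ + b * m *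
        (‖c t‖⁻¹ * (⟪v, e⟫ - ⟪‖c t‖⁻¹ • c t, e⟫ * ⟪v, ‖c t‖⁻¹ • c t⟫))) t := by
  have hr : ‖c t‖ ≠ 0 := norm_ne_zero_iff.2 h0
  have hnorm : HasDerivAt (fun s => ‖c s‖) ⟪v, ‖c t‖⁻¹ • c t⟫ t := by
    have h := hc.norm_sq.sqrt (pow_ne_zero 2 hr)
    simp only [Real.sqrt_sq (norm_nonneg _)] at h
    convert h using 1
    rw [real_inner_smul_right, real_inner_comm]
    field_simp
  have hin : HasDerivAt (fun s => ⟪c s, e⟫) ⟪v, e⟫ t := by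
    simpa using hc.inner ℝ (hasDerivAt_const t e)
  have h := (hnorm.const_mul a).add ((hin.mul (hnorm.inv hr)).const_mul (b * m))
  refine HasDerivAt.congr_deriv h ?_
  simp only [Pi.inv_apply, real_inner_smul_left]
  field_simp
  ring

lemma absolutelyContinuousOnInterval_spiralCalibration_comp {n : ℕ} {a b m δ T : ℝ} {e : Euc n}
    {c : ℝ → Euc n} {K : ℝ≥0} (hc : LipschitzOnWith K c (Icc 0 T)) (hT : 0 ≤ T) (hδ : 0 < δ)
    (hcδ : ∀ t ∈ Icc 0 T, δ ≤ ‖c t‖) :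
    AbsolutelyContinuousOnInterval (fun s => spiralCalibration a b m e (c s)) 0 T := by
  have hnorm : LipschitzOnWith K (fun s => ‖c s‖) (uIcc 0 T) := by
    rw [uIcc_of_le hT]
    simpa [Function.comp_def] using (lipschitzWith_one_norm (E := Euc n)).comp_lipschitzOnWith hc
  have hin : LipschitzOnWith (‖innerSL ℝ e‖₊ * K) (fun s => ⟪c s, e⟫) (uIcc 0 T) := by
    rw [uIcc_of_le hT]
    simpa [Function.comp_def, real_inner_comm] using
      (innerSL ℝ e).lipschitz.comp_lipschitzOnWith hc
  have hinv : LipschitzOnWith (K * Real.toNNReal (δ ^ 2)⁻¹) (fun s => ‖c s‖⁻¹) (uIcc 0 T) := by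
    rw [uIcc_of_le hT] at hnorm ⊢
    apply LipschitzOnWith.of_dist_le_mul
    intro x hx y hy
    have h := hnorm.dist_le_mul x hx y hy
    have hx' := hcδ x hx
    have hy' := hcδ y hy
    have hx0 := hδ.trans_le hx'
    have hy0 := hδ.trans_le hy'
    rw [dist_inv_inv₀ hx0.ne' hy0.ne', norm_norm, norm_norm, NNReal.coe_mul,
      Real.coe_toNNReal _ (by positivity), div_eq_mul_inv]
    calc _ ≤ (K * dist x y) * (δ ^ 2)⁻¹ := by
            rw [sq]; gcongr
      _ = _ := by ring
  exact (hnorm.absolutelyContinuousOnInterval.const_mul a).fun_add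
    ((hin.absolutelyContinuousOnInterval.fun_mul
      hinv.absolutelyContinuousOnInterval).const_mul (b * m))

lemma ofReal_spiralCalibration_sub_le_warpLength {n : ℕ} {G : ℝ → ℝ} {a b m δ T : ℝ} {e : Euc n}
    {c : ℝ → Euc n} {K : ℝ≥0} (hab : a ^ 2 + b ^ 2 ≤ 1) (he : ‖e‖ ≤ 1) (hm : 0 ≤ m)
    (hc : LipschitzOnWith K c (Icc 0 T)) (hT : 0 ≤ T) (hδ : 0 < δ)
    (hcδ : ∀ t ∈ Icc 0 T, δ ≤ ‖c t‖) (hcG : ∀ t ∈ Icc 0 T, m ≤ G ‖c t‖) :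
    ENNReal.ofReal (spiralCalibration a b m e (c T) - spiralCalibration a b m e (c 0)) ≤
      warpLength G c T := by
  rw [← (absolutelyContinuousOnInterval_spiralCalibration_comp hc hT hδ hcδ).integral_deriv_eq_sub,
    intervalIntegral.integral_of_le hT, ← integral_Icc_eq_integral_Ioc]
  refine (Real.ofReal_le_enorm _).trans ((enorm_integral_le_lintegral_enorm _).trans ?_)
  apply lintegral_mono_ae
  have hends : ∀ᵐ t : ℝ, t ≠ 0 ∧ t ≠ T := by
    filter_upwards [compl_mem_ae_iff.2 (measure_singleton (μ := volume) (0 : ℝ)),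
      compl_mem_ae_iff.2 (measure_singleton (μ := volume) T)] with t h1 h2
    exact ⟨h1, h2⟩
  rw [ae_restrict_iff' measurableSet_Icc]
  filter_upwards [hc.ae_differentiableWithinAt_of_mem, hends] with t ht hne hmem
  have hc' : HasDerivAt c (deriv c t) t :=
    ((ht hmem).differentiableAt (Icc_mem_nhds (lt_of_le_of_ne hmem.1 hne.1.symm)
      (lt_of_le_of_ne hmem.2 hne.2))).hasDerivAt
  have h0 : c t ≠ 0 := norm_pos_iff.1 (hδ.trans_le (hcδ t hmem))
  rw [(hasDerivAt_spiralCalibration_comp hc' h0).deriv, Real.enorm_eq_ofReal_abs]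
  exact ENNReal.ofReal_le_ofReal (abs_calibration_le_warpNorm hab he h0 hm (hcG t hmem))

lemma spiralCalibration_sub_le_dist {M : Type*} [MetricSpace M] {n : ℕ} {p : M} {G : ℝ → ℝ}
    {Φ : Euc n ≃ M} (hsym : IsSphericallySymmetric p G Φ) {a b m L : ℝ} {e x y : Euc n}
    (hab : a ^ 2 + b ^ 2 ≤ 1) (he : ‖e‖ ≤ 1) (hm : 0 ≤ m) (hLx : L < ‖x‖)
    (hxy : dist (Φ x) (Φ y) < L) (hG : ∀ r, |r - ‖x‖| < L → m ≤ G r) :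
    spiralCalibration a b m e y - spiralCalibration a b m e x ≤ dist (Φ x) (Φ y) := by
  obtain ⟨-, -, hrad, hdist⟩ := hsym
  apply le_of_forall_gt_imp_ge_of_dense
  intro D hD
  wlog hDL : D < L generalizing D
  · exact (this ((dist (Φ x) (Φ y) + L) / 2) (by linarith) (by linarith)).trans (by linarith)
  have hD0 : 0 < D := dist_nonneg.trans_lt hD
  have hlt := (ENNReal.ofReal_lt_ofReal_iff hD0).2 hD
  rw [hdist x y, sInf_lt_iff] at hlt
  obtain ⟨_, ⟨T, c, hT, rfl, rfl, ⟨K, hc⟩, rfl⟩, hlen⟩ := hlt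
  have hnear : ∀ t ∈ Icc 0 T, |‖c t‖ - ‖c 0‖| < D := by
    intro t ht
    have h1 : ENNReal.ofReal (dist (Φ (c 0)) (Φ (c t))) ≤ warpLength G c T := by
      rw [hdist]
      refine le_trans (sInf_le ⟨t, c, ht.1, rfl, rfl, ⟨K, hc.mono (Icc_subset_Icc_right ht.2)⟩, rfl⟩)
        (lintegral_mono_set (Icc_subset_Icc_right ht.2))
    have h2 := (ENNReal.ofReal_lt_ofReal_iff hD0).1 (h1.trans_lt hlen)
    rw [← hrad, ← hrad]
    refine (abs_dist_sub_le _ _ _).trans_lt ?_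
    rwa [dist_comm]
  have h := ofReal_spiralCalibration_sub_le_warpLength (G := G) (δ := ‖c 0‖ - D) hab he hm hc hT
    (by linarith) (fun t ht => by linarith [(abs_lt.1 (hnear t ht)).1])
    (fun t ht => hG _ ((hnear t ht).trans hDL))
  exact (ENNReal.ofReal_le_ofReal_iff hD0.le).1 (h.trans hlen.le)

lemma eVariationOn_Icc_eq_of_lipschitzOnWith {X : Type*} [PseudoMetricSpace X] {f : ℝ → X}
    {K : ℝ≥0} {T : ℝ} (hT : 0 ≤ T) (hf : LipschitzOnWith K f (Icc 0 T))
    (hlow : ∀ s ∈ Ico 0 T, ∀ k < (K : ℝ),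
      ∀ᶠ t in nhdsWithin s (Ioi s), k * (t - s) ≤ dist (f s) (f t)) :
    eVariationOn f (Icc 0 T) = ENNReal.ofReal (K * T) := by
  have hup : ∀ x ∈ Icc 0 T, ∀ y ∈ Icc 0 T, x ≤ y →
      eVariationOn f (Icc x y) ≤ ENNReal.ofReal (K * (y - x)) := by
    intro x hx y hy hxy
    have h := (hf.mono (Icc_subset_Icc hx.1 hy.2)).comp_eVariationOn_le (mapsTo_id (Icc x y))
    have h2 : eVariationOn (id : ℝ → ℝ) (Icc x y) ≤ ENNReal.ofReal (y - x) := by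
      simpa only [inter_self, id] using ((monotone_id.monotoneOn (Icc x y)).eVariationOn_eq
        (left_mem_Icc.2 hxy) (right_mem_Icc.2 hxy)).le
    rw [ENNReal.ofReal_mul K.coe_nonneg, ENNReal.ofReal_coe_nnreal]
    exact h.trans (mul_le_mul_right h2 _)
  have h0 : (0 : ℝ) ∈ Icc 0 T := left_mem_Icc.2 hT
  have hfin : ∀ x ∈ Icc 0 T, ∀ y ∈ Icc 0 T, x ≤ y → eVariationOn f (Icc x y) ≠ ⊤ :=
    fun x hx y hy hxy => ne_top_of_le_ne_top ENNReal.ofReal_ne_top (hup x hx y hy hxy)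
  set V : ℝ → ℝ := fun t => (eVariationOn f (Icc 0 t)).toReal with hV
  have hadd : ∀ x ∈ Icc 0 T, ∀ y ∈ Icc 0 T, x ≤ y →
      V y = V x + (eVariationOn f (Icc x y)).toReal := by
    intro x hx y hy hxy
    have h := eVariationOn.Icc_add_Icc f (s := univ) hx.1 hxy (mem_univ x)
    simp only [univ_inter] at h
    rw [hV, ← ENNReal.toReal_add (hfin 0 h0 x hx hx.1) (hfin x hx y hy hxy), h]
  have hVlip : LipschitzOnWith K V (Icc 0 T) := by
    apply LipschitzOnWith.of_le_add_mul
    intro x hx y hy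
    rcases le_total x y with hxy | hxy
    · rw [hadd x hx y hy hxy]
      have : 0 ≤ K * dist x y := by positivity
      linarith [(eVariationOn f (Icc x y)).toReal_nonneg]
    · rw [hadd y hy x hx hxy, Real.dist_eq, abs_of_nonneg (sub_nonneg.2 hxy)]
      gcongr
      exact ENNReal.toReal_le_of_le_ofReal (mul_nonneg K.coe_nonneg (sub_nonneg.2 hxy)) (hup y hy x hx hxy)
  have hVT : K * T ≤ V T := by
    have h := image_le_of_liminf_slope_right_le_deriv_boundary (f := fun t => -V t) (a := 0)
      (b := T) (B := fun t => -(K * t)) (B' := fun _ => -(K * 1)) hVlip.continuousOn.neg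
      (by simp [hV]) (by fun_prop)
      (fun x _ => (((hasDerivAt_id x).const_mul (K : ℝ)).neg).hasDerivWithinAt) ?_
      (right_mem_Icc.2 hT)
    · simpa using h
    intro s hs r hr
    obtain ⟨k, hk1, hk2⟩ := exists_between (show -r < (K : ℝ) by linarith)
    apply Eventually.frequently
    filter_upwards [hlow s hs k hk2, self_mem_nhdsWithin,
      Ioo_mem_nhdsGT hs.2] with t ht hst htT
    have hst : s < t := hst
    have hs' : s ∈ Icc 0 T := ⟨hs.1, hs.2.le⟩
    have ht' : t ∈ Icc 0 T := ⟨hs.1.trans hst.le, htT.2.le⟩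
    have h1 : dist (f s) (f t) ≤ (eVariationOn f (Icc s t)).toReal := by
      rw [dist_edist]
      exact ENNReal.toReal_mono (hfin s hs' t ht' hst.le)
        (eVariationOn.edist_le f (left_mem_Icc.2 hst.le) (right_mem_Icc.2 hst.le))
    rw [slope_def_field, div_lt_iff₀ (sub_pos.2 hst), hadd s hs' t ht' hst.le]
    nlinarith
  apply le_antisymm (by simpa using hup 0 h0 T (right_mem_Icc.2 hT) hT)
  exact ENNReal.ofReal_le_of_le_toReal hVT

/-- The great-circle arc starting at `u` with initial velocity `w`. -/
def greatCircle {n : ℕ} (u w : Euc n) (s : ℝ) : Euc n := Real.cos s • u + Real.sin s • w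

section GreatCircle

variable {n : ℕ} {u w : Euc n}

lemma inner_greatCircle (hu : ‖u‖ = 1) (hw : ‖w‖ = 1) (hwu : ⟪w, u⟫ = 0) (s t : ℝ) :
    ⟪greatCircle u w s, greatCircle u w t⟫ = Real.cos (s - t) := by
  have huw : ⟪u, w⟫ = 0 := by rw [real_inner_comm, hwu]
  simp only [greatCircle, inner_add_left, inner_add_right, real_inner_smul_left,
    real_inner_smul_right, real_inner_self_eq_norm_sq, hu, hw, hwu, huw, Real.cos_sub]
  ring

lemma norm_greatCircle (hu : ‖u‖ = 1) (hw : ‖w‖ = 1) (hwu : ⟪w, u⟫ = 0) (s : ℝ) :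
    ‖greatCircle u w s‖ = 1 := by
  have h := inner_greatCircle hu hw hwu s s
  rw [sub_self, Real.cos_zero, real_inner_self_eq_norm_sq] at h
  exact (pow_eq_one_iff_of_nonneg (norm_nonneg _) two_ne_zero).1 h

lemma norm_greatCircle_tangent (hu : ‖u‖ = 1) (hw : ‖w‖ = 1) (hwu : ⟪w, u⟫ = 0) (s : ℝ) :
    ‖greatCircle w (-u) s‖ = 1 :=
  norm_greatCircle hw (by rwa [norm_neg]) (by rw [inner_neg_left, real_inner_comm, hwu, neg_zero]) s

lemma inner_greatCircle_tangent (hu : ‖u‖ = 1) (hw : ‖w‖ = 1) (hwu : ⟪w, u⟫ = 0) (s t : ℝ) :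
    ⟪greatCircle u w s, greatCircle w (-u) t⟫ = Real.sin (s - t) := by
  have huw : ⟪u, w⟫ = 0 := by rw [real_inner_comm, hwu]
  simp only [greatCircle, inner_add_left, inner_add_right, real_inner_smul_left, inner_neg_right,
    real_inner_smul_right, real_inner_self_eq_norm_sq, hu, hw, hwu, huw, Real.sin_sub]
  ring

lemma hasDerivAt_greatCircle (u w : Euc n) (s : ℝ) :
    HasDerivAt (greatCircle u w) (greatCircle w (-u) s) s := by
  refine HasDerivAt.congr_deriv (((Real.hasDerivAt_cos s).smul_const u).add
    ((Real.hasDerivAt_sin s).smul_const w)) ?_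
  rw [greatCircle, neg_smul, smul_neg, add_comm]

lemma hasDerivAt_smul_greatCircle {α : ℝ → ℝ} {k l t : ℝ} (hα : HasDerivAt α k t) :
    HasDerivAt (fun s => (l + s) • greatCircle u w (α s))
      (greatCircle u w (α t) + ((l + t) * k) • greatCircle w (-u) (α t)) t := by
  refine HasDerivAt.congr_deriv (((hasDerivAt_id t).const_add l).smul
    ((hasDerivAt_greatCircle u w (α t)).scomp t hα)) ?_
  simp only [id, one_smul, smul_smul]
  rw [add_comm]

end GreatCircle

lemma warpNorm_smul_unit {n : ℕ} {G : ℝ → ℝ} {u v : Euc n} {r k : ℝ} (hr : 0 < r) (hu : ‖u‖ = 1)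
    (hv : ‖v‖ = 1) (huv : ⟪u, v⟫ = 0) :
    warpNorm G (r • u) (u + (r * k) • v) = Real.sqrt (1 + (G r * k) ^ 2) := by
  have hnorm : ‖r • u‖ = r := by rw [norm_smul, hu, mul_one, Real.norm_of_nonneg hr.le]
  have h0 : r • u ≠ 0 := norm_pos_iff.1 (hnorm.symm ▸ hr)
  have hvu : ⟪v, u⟫ = 0 := by rw [real_inner_comm, huv]
  have h1 : ⟪u + (r * k) • v, u⟫ = 1 := by
    rw [inner_add_left, real_inner_smul_left, hvu, real_inner_self_eq_norm_sq, hu]; norm_num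
  have h2 : ‖u + (r * k) • v‖ ^ 2 = 1 + (r * k) ^ 2 := by
    rw [norm_add_sq_real, real_inner_smul_right, huv, norm_smul, hu, hv, Real.norm_eq_abs,
      mul_one, sq_abs]
    norm_num
  rw [warpNorm, if_neg h0, hnorm, inv_smul_smul₀ hr.ne', h1, h2]
  congr 1
  field_simp
  ring

section Spiral

variable {M : Type*} [MetricSpace M] {n : ℕ} {p : M} {G : ℝ → ℝ} {Φ : Euc n ≃ M}
  {u w : Euc n} {α : ℝ → ℝ} {lam l : ℝ}

lemma dist_spiral_le (hsym : IsSphericallySymmetric p G Φ) (hu : ‖u‖ = 1) (hw : ‖w‖ = 1)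
    (hwu : ⟪w, u⟫ = 0) (hlam : 1 ≤ lam) (hl : 0 < l)
    (hα : ∀ t, 0 ≤ t → HasDerivAt α (Real.sqrt (lam ^ 2 - 1) * (G (l + t))⁻¹) t)
    {s t : ℝ} (hs : 0 ≤ s) (hst : s ≤ t) :
    dist (Φ ((l + s) • greatCircle u w (α s))) (Φ ((l + t) • greatCircle u w (α t))) ≤
      lam * (t - s) := by
  obtain ⟨⟨hGpos, hGsmooth, -, -⟩, -, -, hdist⟩ := hsym
  have hts : 0 ≤ t - s := sub_nonneg.2 hst
  rw [← ENNReal.ofReal_le_ofReal_iff (by positivity), hdist]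
  set β := Real.sqrt (lam ^ 2 - 1) with hβ
  have hβsq : β ^ 2 = lam ^ 2 - 1 := Real.sq_sqrt (by nlinarith)
  set c : ℝ → Euc n := fun r => (l + (s + r)) • greatCircle u w (α (s + r)) with hc
  set d : ℝ → ℝ := fun r => (l + (s + r)) * (β * (G (l + (s + r)))⁻¹) with hd
  have hderiv : ∀ r, 0 ≤ r → HasDerivAt c
      (greatCircle u w (α (s + r)) + d r • greatCircle w (-u) (α (s + r))) r := by
    intro r hr
    exact (hasDerivAt_smul_greatCircle (hα (s + r) (by positivity))).comp_const_add s r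
  have hdcont : ContinuousOn d (Icc 0 (t - s)) := by
    have hG : ContinuousOn (fun r => G (l + (s + r))) (Icc 0 (t - s)) :=
      hGsmooth.continuousOn.comp (by fun_prop) fun r hr => by
        have := hr.1
        exact mem_Ioi.2 (by positivity)
    refine ContinuousOn.mul (by fun_prop) (continuousOn_const.mul (hG.inv₀ fun r hr => ?_))
    have := hr.1
    exact (hGpos _ (by positivity)).ne'
  obtain ⟨C, hC⟩ := isCompact_Icc.exists_bound_of_continuousOn hdcont
  have hlip : LipschitzOnWith (Real.toNNReal (1 + C)) c (Icc 0 (t - s)) := by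
    refine (convex_Icc _ _).lipschitzOnWith_of_nnnorm_hasDerivWithin_le
      (fun r hr => (hderiv r hr.1).hasDerivWithinAt) fun r hr => ?_
    rw [← NNReal.coe_le_coe, coe_nnnorm]
    refine (norm_add_le _ _).trans (le_trans ?_ (Real.le_coe_toNNReal _))
    rw [norm_smul, norm_greatCircle hu hw hwu, norm_greatCircle_tangent hu hw hwu, mul_one]
    gcongr
    exact hC r hr
  have hlen : warpLength G c (t - s) = ENNReal.ofReal (lam * (t - s)) := by
    have hspeed : ∀ r ∈ Icc 0 (t - s),
        ENNReal.ofReal (warpNorm G (c r) (deriv c r)) = ENNReal.ofReal lam := by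
      intro r hr
      have hr0 := hr.1
      have hpos : 0 < l + (s + r) := by positivity
      rw [(hderiv r hr.1).deriv, hc, hd, warpNorm_smul_unit hpos (norm_greatCircle hu hw hwu _)
        (norm_greatCircle_tangent hu hw hwu _)
        (by rw [inner_greatCircle_tangent hu hw hwu, sub_self, Real.sin_zero]),
        mul_comm β, mul_inv_cancel_left₀ (hGpos _ hpos).ne', hβsq, add_sub_cancel,
        Real.sqrt_sq (by linarith)]
    rw [warpLength, setLIntegral_congr_fun measurableSet_Icc hspeed, setLIntegral_const,
      Real.volume_Icc, sub_zero, ENNReal.ofReal_mul (by linarith)]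
  exact sInf_le ⟨t - s, c, hts, by simp [hc], by simp [hc], ⟨_, hlip⟩, hlen.symm⟩

lemma eventually_mul_le_dist_spiral (hsym : IsSphericallySymmetric p G Φ) (hu : ‖u‖ = 1)
    (hw : ‖w‖ = 1) (hwu : ⟪w, u⟫ = 0) (hlam : 1 ≤ lam) (hl : 0 < l)
    (hα : ∀ t, 0 ≤ t → HasDerivAt α (Real.sqrt (lam ^ 2 - 1) * (G (l + t))⁻¹) t)
    {s k : ℝ} (hs : 0 ≤ s) (hk : k < lam) :
    ∀ᶠ t in nhdsWithin s (Ioi s), k * (t - s) ≤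
      dist (Φ ((l + s) • greatCircle u w (α s))) (Φ ((l + t) • greatCircle u w (α t))) := by
  have hGpos := hsym.1.1
  have hls : 0 < l + s := by positivity
  have hlam0 : 0 < lam := by linarith
  have hG0 := hGpos _ hls
  set β := Real.sqrt (lam ^ 2 - 1) with hβ
  have hβsq : β ^ 2 = lam ^ 2 - 1 := Real.sq_sqrt (by nlinarith)
  obtain ⟨m, ⟨hm0, hmG⟩, hmk⟩ : ∃ m ∈ Ioo 0 (G (l + s)),
      k < lam⁻¹ + β / lam * m * (β * (G (l + s))⁻¹) := by
    have hcont : Continuous fun m => lam⁻¹ + β / lam * m * (β * (G (l + s))⁻¹) := by fun_prop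
    have hval : lam⁻¹ + β / lam * G (l + s) * (β * (G (l + s))⁻¹) = lam := by
      field_simp
      linarith
    have hev := (hcont.tendsto (G (l + s))).eventually_const_lt (u := k) (by rwa [hval])
    exact ((show ∀ᶠ m in nhdsWithin (G (l + s)) (Iio (G (l + s))), m ∈ Ioo 0 (G (l + s)) from
      Ioo_mem_nhdsLT hG0).and (nhdsWithin_le_nhds hev)).exists
  have hGcont : ContinuousAt G (l + s) :=
    hsym.1.2.1.continuousOn.continuousAt (Ioi_mem_nhds hls)
  obtain ⟨L, hL0, hL⟩ := Metric.eventually_nhds_iff.1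
    (((hGcont.eventually_const_lt hmG).and (eventually_gt_nhds hls)))
  have hLs : L ≤ l + s := by
    by_contra! h
    have := (@hL 0 (by rwa [Real.dist_eq, zero_sub, abs_neg, abs_of_pos hls])).2
    exact lt_irrefl _ this
  have hnorm : ∀ t, 0 ≤ t → ‖(l + t) • greatCircle u w (α t)‖ = l + t := fun t ht => by
    rw [norm_smul, norm_greatCircle hu hw hwu, mul_one, Real.norm_of_nonneg (by positivity)]
  set e := greatCircle w (-u) (α s) with he
  have hcal : ∀ t, 0 ≤ t → spiralCalibration lam⁻¹ (β / lam) m e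
      ((l + t) • greatCircle u w (α t)) =
      lam⁻¹ * (l + t) + β / lam * m * Real.sin (α t - α s) := by
    intro t ht
    rw [spiralCalibration, hnorm t ht, real_inner_smul_left, inner_greatCircle_tangent hu hw hwu,
      mul_comm (l + t) (Real.sin _), mul_inv_cancel_right₀ (by positivity)]
  have hder : HasDerivAt (fun t => lam⁻¹ * (l + t) + β / lam * m * Real.sin (α t - α s))
      (lam⁻¹ + β / lam * m * (β * (G (l + s))⁻¹)) s := by
    have h1 := ((hasDerivAt_id s).const_add l).const_mul lam⁻¹
    have h2 := (((hα s hs).sub_const (α s)).sin).const_mul (β / lam * m)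
    refine (h1.add h2).congr_deriv ?_
    simp
  have hslope := (hasDerivWithinAt_iff_tendsto_slope' (by simp)).1
    (hder.hasDerivWithinAt (s := Ioi s))
  have hsmall : ∀ᶠ t in nhdsWithin s (Ioi s), lam * (t - s) < L / 2 := by
    apply nhdsWithin_le_nhds
    have hcont : Continuous fun t => lam * (t - s) := by fun_prop
    exact (hcont.tendsto s).eventually_lt_const (by simpa using hL0)
  filter_upwards [hslope.eventually_const_lt hmk, hsmall, self_mem_nhdsWithin] with t ht htL hst
  have hst : s < t := hst
  have ht0 : 0 ≤ t := hs.trans hst.le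
  have hd := dist_spiral_le hsym hu hw hwu hlam hl hα hs hst.le
  rw [slope_def_field, lt_div_iff₀ (sub_pos.2 hst), ← hcal t ht0, ← hcal s hs] at ht
  refine ht.le.trans (spiralCalibration_sub_le_dist hsym (L := L / 2) ?_
    (norm_greatCircle_tangent hu hw hwu _).le hm0.le ?_ (hd.trans_lt htL) ?_)
  · rw [inv_pow, div_pow, hβsq]
    field_simp
    linarith
  · rw [hnorm s hs]; linarith
  · rw [hnorm s hs]
    intro r hr
    exact (hL (show dist r (l + s) < L by rw [Real.dist_eq]; linarith)).1.le

end Spiral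

lemma not_mem_of_avoidsA {M : Type*} [MetricSpace M] {p q : M} {lam : ℝ} {A B : ℝ → Set M}
    (hAB : IsGrowthCompetition p q lam A B) {t : ℝ} {x : M} (ht : 0 ≤ t) (hx : x ≠ p)
    (hxt : t ≤ dist x p) : x ∉ B t := by
  rcases ht.eq_or_lt with rfl | ht
  · rwa [hAB.B_zero, mem_singleton_iff]
  · rw [hAB.B_eq t ht]
    rintro ⟨η, ⟨h0, hη, -⟩, r, hr, rfl⟩
    have h := hη.dist_le_mul r ⟨hr.1, hr.2.le⟩ 0 ⟨le_rfl, ht.le⟩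
    rw [h0, Real.dist_eq, sub_zero, abs_of_nonneg hr.1, NNReal.coe_one, one_mul] at h
    linarith [hr.2]

lemma tendsto_integral_inv_atTop_of_parabolicWarping {G : ℝ → ℝ} (hG : IsWarping G)
    (hpar : ParabolicWarping G) {l : ℝ} (hl : 0 < l) :
    Tendsto (fun t => ∫ s in (0 : ℝ)..t, (G (l + s))⁻¹) atTop atTop := by
  obtain ⟨hGpos, hGsmooth, -, -⟩ := hG
  have hcont : ContinuousOn (fun r => (G r)⁻¹) (Ioi 0) :=
    hGsmooth.continuousOn.inv₀ fun r hr => (hGpos r hr).ne'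
  have hII : ∀ x y, 0 < x → 0 < y → IntervalIntegrable (fun r => (G r)⁻¹) volume x y :=
    fun x y hx hy => (hcont.mono fun r hr => (lt_min hx hy).trans_le hr.1).intervalIntegrable
  have hsub : ∀ t, ∫ s in (0 : ℝ)..t, (G (l + s))⁻¹ = ∫ r in l..(l + t), (G r)⁻¹ := fun t => by
    rw [intervalIntegral.integral_comp_add_left (fun r => (G r)⁻¹), add_zero]
  rw [tendsto_atTop_atTop]
  by_contra! hbdd
  obtain ⟨C, hC⟩ := hbdd
  have hle : ∀ t, 0 ≤ t → ∫ r in l..(l + t), (G r)⁻¹ ≤ C := by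
    intro t ht
    obtain ⟨T, hT, hTC⟩ := hC t
    rw [hsub] at hTC
    refine le_trans ?_ hTC.le
    rw [← intervalIntegral.integral_add_adjacent_intervals (hII l (l + t) hl (by positivity))
      (hII (l + t) (l + T) (by positivity) (by linarith))]
    refine le_add_of_nonneg_right (intervalIntegral.integral_nonneg (by linarith) fun r hr => ?_)
    exact (inv_pos.2 (hGpos r (by linarith [hr.1]))).le
  have hint : IntegrableOn (fun r => (G r)⁻¹) (Ioi l) := by
    refine integrableOn_Ioi_of_intervalIntegral_norm_bounded C l (b := fun t : ℝ => l + max t 0)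
      (l := atTop) (fun t => ?_) ?_ ?_
    · exact (hII l _ hl (by positivity)).1
    · exact tendsto_atTop_add_const_left _ _ (tendsto_atTop_mono (fun t => le_max_left t 0) tendsto_id)
    · refine Eventually.of_forall fun t => ?_
      rw [intervalIntegral.integral_congr (g := fun r => (G r)⁻¹)]
      · exact hle _ (le_max_right _ _)
      · intro r hr
        rw [uIcc_of_le (by simp)] at hr
        exact Real.norm_of_nonneg (inv_pos.2 (hGpos r (hl.trans_le hr.1))).le
  have hint1 : IntegrableOn (fun r => (G r)⁻¹) (Ici 1) := by
    rw [integrableOn_Ici_iff_integrableOn_Ioi]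
    refine IntegrableOn.mono_set ((hII 1 (max 1 l) one_pos (by positivity)).1.union
      (hint.mono_set (Ioi_subset_Ioi (le_max_right 1 l)))) ?_
    rw [Ioc_union_Ioi_eq_Ioi (le_max_left _ _)]
  refine hint1.2.ne (hpar ▸ ?_)
  refine setLIntegral_congr_fun measurableSet_Ici fun r hr => ?_
  exact Real.enorm_of_nonneg (inv_pos.2 (hGpos r (one_pos.trans_le hr))).le

/-- the spiral path from the proof of Proposition 3.1.
Suppose `M` is spherically symmetric about `p`.  Fix a unit `θ ∈ S_pM`,
written as `θ = cos τ • u₀ + sin τ • w` with `w ⟂ u₀` a unit vector and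
`0 ≤ τ ≤ π`, let `η(s) = cos s • u₀ + sin s • w` be the corresponding
unit-speed great-circle arc with `η 0 = u₀`, `η τ = θ`, set
`α(t) = √(λ²−1) ∫₀ᵗ G(ℓ+s)⁻¹ ds` (with `ℓ = d(p,q)`) and, in polar
coordinates, `γ(t) = (ℓ + t, η(α t))`.  Then `γ 0 = q`, `γ` has constant
speed `λ`, and `d(γ(t), p) = ℓ + t`; hence for any growth competition
`{A_t, B_t}` between `p` and `q`, `γ` is a path avoiding `B`.  Moreover if
`∫₁^∞ dr/G(r) = ∞` then `α(t) → ∞`, so there is `T` with `α T = τ`, at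
which time `γ T = (ℓ + T, θ)` lies on the geodesic ray from `p` in
direction `θ`. -/
theorem spiral_path_avoids_B
    {M : Type*} [MetricSpace M] [ProperSpace M] {n : ℕ}
    (p : M) (G : ℝ → ℝ) (Φ : Euc n ≃ M)
    (hsym : IsSphericallySymmetric p G Φ)
    (q : M) (hq : q ≠ p) (lam : ℝ) (hlam : 1 < lam)
    (w : Euc n) (hw : ‖w‖ = 1) (hwu : ⟪w, polarTheta Φ q⟫ = 0)
    (τ : ℝ) (hτ0 : 0 ≤ τ) (hτPi : τ ≤ Real.pi)
    (θ : Euc n) (hθ : θ = Real.cos τ • polarTheta Φ q + Real.sin τ • w)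
    (η : ℝ → Euc n)
    (hη : η = fun s => Real.cos s • polarTheta Φ q + Real.sin s • w)
    (α : ℝ → ℝ)
    (hα : α = fun t => Real.sqrt (lam ^ 2 - 1) *
      ∫ s in (0 : ℝ)..t, (G (dist p q + s))⁻¹)
    (γ : ℝ → M) (hγ : γ = fun t => Φ ((dist p q + t) • η (α t))) :
    γ 0 = q ∧
    (∀ T : ℝ, 0 ≤ T → LipschitzOnWith (Real.toNNReal lam) γ (Set.Icc 0 T) ∧
      pathLength γ T = ENNReal.ofReal (lam * T)) ∧
    (∀ t : ℝ, 0 ≤ t → dist (γ t) p = dist p q + t) ∧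
    (∀ A B : ℝ → Set M, IsGrowthCompetition p q lam A B →
      ∀ T : ℝ, 0 ≤ T → AvoidsB q lam B T γ) ∧
    (ParabolicWarping G →
      Tendsto α atTop atTop ∧
        ∃ T : ℝ, 0 ≤ T ∧ α T = τ ∧ γ T = Φ ((dist p q + T) • θ)) := by
  have hGw := hsym.1
  obtain ⟨hGpos, hGsmooth, -, -⟩ := hGw
  set l := dist p q with hl_def
  have hl : 0 < l := dist_pos.2 hq.symm
  set u := polarTheta Φ q with hu_def
  have hΦq : ‖Φ.symm q‖ = l := by rw [← hsym.2.2.1, Φ.apply_symm_apply, dist_comm]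
  have hu : ‖u‖ = 1 := by
    rw [hu_def, polarTheta, norm_smul, norm_inv, norm_norm, hΦq, inv_mul_cancel₀ hl.ne']
  have hlu : l • u = Φ.symm q := by rw [hu_def, polarTheta, hΦq, smul_inv_smul₀ hl.ne']
  have hγ' : ∀ t, γ t = Φ ((l + t) • greatCircle u w (α t)) := fun t => by
    rw [hγ, hη]; rfl
  have hα0 : α 0 = 0 := by rw [hα]; simp
  have hαderiv : ∀ t, 0 ≤ t → HasDerivAt α (Real.sqrt (lam ^ 2 - 1) * (G (l + t))⁻¹) t := by
    intro t ht
    have hcont : ContinuousOn (fun s => (G (l + s))⁻¹) (Ioi (-l)) := by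
      refine (hGsmooth.continuousOn.comp (t := Ioi 0) (by fun_prop) fun s hs => ?_).inv₀
        fun s hs => (hGpos _ ?_).ne'
      · exact mem_Ioi.2 (by linarith [mem_Ioi.1 hs])
      · linarith [mem_Ioi.1 hs]
    have htl : t ∈ Ioi (-l) := mem_Ioi.2 (by linarith)
    rw [hα]
    refine (intervalIntegral.integral_hasDerivAt_right (ContinuousOn.intervalIntegrable
      (hcont.mono fun s hs => ?_)) (hcont.stronglyMeasurableAtFilter isOpen_Ioi t htl)
      (hcont.continuousAt (Ioi_mem_nhds htl))).const_mul _
    rw [uIcc_of_le ht] at hs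
    exact mem_Ioi.2 (by linarith [hs.1])
  have hstart : γ 0 = q := by
    rw [hγ', hα0, greatCircle]
    simp [hlu]
  have hlip : ∀ T : ℝ, 0 ≤ T → LipschitzOnWith (Real.toNNReal lam) γ (Icc 0 T) := by
    intro T hT
    apply LipschitzOnWith.of_dist_le_mul
    intro s hs t ht
    rw [Real.coe_toNNReal _ (by linarith)]
    wlog hst : s ≤ t generalizing s t
    · rw [dist_comm, dist_comm s]
      exact this t ht s hs (le_of_not_ge hst)
    rw [dist_comm s, Real.dist_eq, abs_of_nonneg (sub_nonneg.2 hst), hγ', hγ']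
    exact dist_spiral_le hsym hu hw hwu hlam.le hl hαderiv hs.1 hst
  have hrad : ∀ t : ℝ, 0 ≤ t → dist (γ t) p = l + t := by
    intro t ht
    rw [hγ', hsym.2.2.1, norm_smul, norm_greatCircle hu hw hwu, mul_one,
      Real.norm_of_nonneg (by positivity)]
  refine ⟨hstart, fun T hT => ⟨hlip T hT, ?_⟩, hrad, fun A B hAB T hT => ⟨hstart, hlip T hT, ?_⟩,
    fun hpar => ?_⟩
  · have h := eVariationOn_Icc_eq_of_lipschitzOnWith hT (hlip T hT) fun s hs k hk => by
      simp only [hγ']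
      rw [Real.coe_toNNReal _ (by linarith)] at hk
      exact eventually_mul_le_dist_spiral hsym hu hw hwu hlam.le hl hαderiv hs.1 hk
    rwa [Real.coe_toNNReal _ (by linarith)] at h
  · intro s hs
    have hd := hrad s hs.1
    refine not_mem_of_avoidsA hAB hs.1 (dist_pos.1 ?_) ?_ <;> linarith [hs.1]
  · have hβ : 0 < Real.sqrt (lam ^ 2 - 1) := Real.sqrt_pos.2 (by nlinarith)
    have htend : Tendsto α atTop atTop := by
      rw [hα]
      exact (tendsto_integral_inv_atTop_of_parabolicWarping hsym.1 hpar hl).const_mul_atTop hβ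
    refine ⟨htend, ?_⟩
    obtain ⟨b, hb, hb0⟩ := ((htend.eventually_ge_atTop τ).and (eventually_ge_atTop 0)).exists
    obtain ⟨T, hT, hTτ⟩ := intermediate_value_Icc hb0
      (fun t ht => (hαderiv t ht.1).continuousAt.continuousWithinAt)
      (show τ ∈ Icc (α 0) (α b) from ⟨hα0.trans_le hτ0, hb⟩)
    exact ⟨T, hT.1, hTτ, by rw [hγ', hTτ, hθ, greatCircle]⟩

end GrowthComp
end
end

section
/- Consider the growth competition on the Euclidean plane ℝ² with p = (0,0), q = (ℓ,0) for some ℓ > 0, and λ > 1. Then the visibility angle equals a = π/2: a boundary point x ∈ ∂Ω is visible (the segment [q,x] does not meet Ω) if and only if x lies in the closed right half-plane {x₁ ≥ 0}; moreover ∂Ω ∩ {x₁ ≥ 0} = ∂Ω_1 ∩ {x₁ ≥ 0}, which is an arc of the Apollonius circle {y ∈ ℝ² : |y − q| = λ|y|}. -/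
/-!
Formalization framework for "growth competitions" (after the paper's
Section 2), at the metric-space level.

Since Mathlib does not yet have Riemannian metrics, a complete Riemannian
manifold is represented by a proper (hence complete; Hopf-Rinow) metric
space whose distance is the induced length (intrinsic) metric, and
spherical symmetry about `p` with warping function `G` is expressed through
global geodesic polar normal coordinates `Φ : ℝⁿ ≃ M` with `Φ 0 = p` and
`dist (Φ x) p = ‖x‖`, in which the Riemannian distance is the infimum of
lengths of Lipschitz curves measured in the warped metric
`g = dr² + G(r)² dθ²`.
-/

open Set Metric Filter MeasureTheory InnerProductGeometry NNReal ENNReal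
open scoped RealInnerProductSpace Classical

noncomputable section

namespace GrowthComp

variable {M : Type*} [MetricSpace M]

section NormedSpace

variable {E : Type*} [NormedAddCommGroup E] [NormedSpace ℝ E]

lemma eVariationOn_Icc_le_of_lipschitzOnWith {γ : ℝ → M} {a b : ℝ} {K : ℝ≥0}
    (h : LipschitzOnWith K γ (Icc a b)) :
    eVariationOn γ (Icc a b) ≤ K * ENNReal.ofReal (b - a) := by
  have h1 := h.comp_eVariationOn_le (f := γ) (g := id) (s := Icc a b) (mapsTo_id _)
  have h2 : eVariationOn (id : ℝ → ℝ) (Icc a b) ≤ ENNReal.ofReal (b - a) := by simp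
  exact h1.trans (by gcongr)

/-- A broken line `[x, y] ∪ [y, z]` avoiding `S` bounds the intrinsic distance. -/
lemma dCompl_le_of_broken_line {S : Set E} {x y z : E}
    (hxy : ∀ w ∈ segment ℝ x y, w ∉ S) (hyz : ∀ w ∈ segment ℝ y z, w ∉ S) :
    dCompl S x z ≤ ENNReal.ofReal (dist x y + dist y z) := by
  let γ : ℝ → E := fun t => x + (min t 1) • (y - x) + (max (t - 1) 0) • (z - y)
  have hγ1 : ∀ t ≤ 1, γ t = AffineMap.lineMap x y t := by
    intro t ht
    simp only [γ, min_eq_left ht, max_eq_right (sub_nonpos.2 ht), AffineMap.lineMap_apply,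
      vsub_eq_sub, vadd_eq_add, zero_smul]
    abel
  have hγ2 : ∀ t, 1 ≤ t → γ t = AffineMap.lineMap y z (t - 1) := by
    intro t ht
    simp only [γ, min_eq_right ht, max_eq_left (sub_nonneg.2 ht), AffineMap.lineMap_apply,
      vsub_eq_sub, vadd_eq_add, one_smul]
    abel
  have hlip1 : LipschitzOnWith (nndist x y) γ (Icc 0 1) := by
    refine LipschitzOnWith.of_dist_le_mul fun s hs t ht => ?_
    rw [hγ1 s hs.2, hγ1 t ht.2, dist_lineMap_lineMap, coe_nndist, mul_comm]
  have hlip2 : LipschitzOnWith (nndist y z) γ (Icc 1 2) := by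
    refine LipschitzOnWith.of_dist_le_mul fun s hs t ht => ?_
    rw [hγ2 s hs.1, hγ2 t ht.1, dist_lineMap_lineMap, coe_nndist, mul_comm, dist_sub_right]
  have hlip : LipschitzOnWith (nndist x y + nndist y z) γ (Icc 0 2) := by
    refine LipschitzOnWith.of_dist_le_mul fun s _ t _ => ?_
    have e : γ s - γ t = (min s 1 - min t 1) • (y - x)
        + (max (s - 1) 0 - max (t - 1) 0) • (z - y) := by
      simp only [γ, sub_smul]; abel
    have h1 : |min s 1 - min t 1| ≤ dist s t := by
      simpa [Real.dist_eq] using abs_min_sub_min_le_max s 1 t 1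
    have h2 : |max (s - 1) 0 - max (t - 1) 0| ≤ dist s t := by
      simpa [Real.dist_eq] using abs_max_sub_max_le_abs (s - 1) (t - 1) 0
    rw [dist_eq_norm, e]
    refine (norm_add_le _ _).trans ?_
    rw [norm_smul, norm_smul, Real.norm_eq_abs, Real.norm_eq_abs, NNReal.coe_add, coe_nndist,
      coe_nndist, dist_comm x y, dist_comm y z, dist_eq_norm, dist_eq_norm z y, add_mul,
      mul_comm ‖y - x‖, mul_comm ‖z - y‖]
    gcongr
  have hle : dCompl S x z ≤ pathLength γ 2 := by
    refine sInf_le ⟨2, γ, by norm_num, ?_, ?_, ⟨_, hlip⟩, ?_, rfl⟩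
    · simp [hγ1]
    · rw [hγ2 2 (by norm_num)]; norm_num
    · intro t ht
      rcases le_total t 1 with h | h
      · rw [hγ1 t h]
        exact hxy _ (by rw [segment_eq_image_lineMap]; exact ⟨t, ⟨ht.1, h⟩, rfl⟩)
      · rw [hγ2 t h]
        refine hyz _ ?_
        rw [segment_eq_image_lineMap]
        exact ⟨t - 1, ⟨by linarith, by linarith [ht.2]⟩, rfl⟩
  have hsum := eVariationOn.Icc_add_Icc γ (s := univ) (a := 0) (b := 1) (c := 2)
    (by norm_num) (by norm_num) (mem_univ _)
  simp only [univ_inter] at hsum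
  refine hle.trans ?_
  rw [pathLength, ← hsum, ENNReal.ofReal_add dist_nonneg dist_nonneg]
  gcongr
  · have := eVariationOn_Icc_le_of_lipschitzOnWith hlip1
    simpa [← edist_nndist, edist_dist] using this
  · have := eVariationOn_Icc_le_of_lipschitzOnWith hlip2
    norm_num at this
    simpa [← edist_nndist, edist_dist] using this

lemma dCompl_le_of_segment {S : Set E} {x y : E} (h : ∀ w ∈ segment ℝ x y, w ∉ S) :
    dCompl S x y ≤ ENNReal.ofReal (dist x y) := by
  simpa using dCompl_le_of_broken_line (x := x)
    (by simpa using h x (left_mem_segment ℝ x y)) h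

lemma edist_le_dCompl (S : Set M) (x y : M) : edist x y ≤ dCompl S x y := by
  refine le_sInf ?_
  rintro L ⟨T, γ, hT, h0, h1, -, -, rfl⟩
  rw [← h0, ← h1]
  exact eVariationOn.edist_le γ (left_mem_Icc.2 hT) (right_mem_Icc.2 hT)

lemma mem_omegaSeq_one {p q : E} {lam : ℝ} {x : E} :
    x ∈ OmegaSeq p q lam 1 ↔ ENNReal.ofReal (lam * dist x p) < ENNReal.ofReal (dist x q) := by
  have : dCompl (∅ : Set E) x q = ENNReal.ofReal (dist x q) :=
    le_antisymm (dCompl_le_of_segment (by simp)) (edist_dist x q ▸ edist_le_dCompl _ _ _)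
  simp [OmegaSeq, this]

lemma mem_Omega {p q : M} {lam : ℝ} {x : M} :
    x ∈ Omega p q lam ↔ ∃ n, x ∈ OmegaSeq p q lam n := by
  simp only [Omega, mem_iUnion]
  exact ⟨fun ⟨n, h⟩ => ⟨_, h⟩, fun ⟨n, h⟩ => ⟨n, Or.inl h⟩⟩

/-- A point that sees `q` past `Ω₁` never falls into `Ω`. -/
lemma not_mem_Omega_of_segment {p q : E} {lam : ℝ} {x : E}
    (hx : ∀ y ∈ segment ℝ x q, y ∉ OmegaSeq p q lam 1) : x ∉ Omega p q lam := by
  rw [mem_Omega]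
  push Not
  intro n
  induction n generalizing x with
  | zero => simp [OmegaSeq]
  | succ n ih =>
    have hseg : ∀ y ∈ segment ℝ x q, y ∉ OmegaSeq p q lam n := fun y hy =>
      ih fun z hz => hx z ((convex_segment x q).segment_subset hy (right_mem_segment ℝ x q) hz)
    rintro (h | ⟨-, h⟩)
    · exact hseg x (left_mem_segment ℝ x q) h
    · exact hx x (left_mem_segment ℝ x q)
        (mem_omegaSeq_one.2 (h.trans_le (dCompl_le_of_segment hseg)))

/-- A point that sees `q` past `Ω₁` and is strictly closer to `q` (in time) than to `p` stays
away from `Ω`. -/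
lemma not_mem_closure_Omega {p q : E} {lam : ℝ} (hlam : 0 < lam) {x : E}
    (hx : ∀ y ∈ segment ℝ x q, y ∉ OmegaSeq p q lam 1) (hd : dist x q < lam * dist x p) :
    x ∉ closure (Omega p q lam) := by
  obtain ⟨ε, hε, hεd⟩ : ∃ ε > 0, dist x q + (1 + lam) * ε = lam * dist x p :=
    ⟨(lam * dist x p - dist x q) / (1 + lam), div_pos (by linarith) (by linarith), by
      field_simp; ring⟩
  have key : ∀ n, ∀ y ∈ ball x ε, y ∉ OmegaSeq p q lam n := by
    intro n
    induction n with
    | zero => simp [OmegaSeq]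
    | succ n ih =>
      rintro y hy (h | ⟨-, h⟩)
      · exact ih y hy h
      · refine h.not_ge ((dCompl_le_of_broken_line (y := x) (fun w hw => ih w ?_)
          fun w hw hwn => ?_).trans (ENNReal.ofReal_le_ofReal ?_))
        · exact (convex_ball x ε).segment_subset hy (mem_ball_self hε) hw
        · exact not_mem_Omega_of_segment
            (fun z hz => hx z ((convex_segment x q).segment_subset hw
              (right_mem_segment ℝ x q) hz)) (mem_Omega.2 ⟨n, hwn⟩)
        · rw [mem_ball] at hy
          have := dist_triangle_left x p y
          nlinarith
  rw [mem_closure_iff_nhds]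
  intro h
  obtain ⟨y, hy, hyΩ⟩ := h _ (ball_mem_nhds x hε)
  obtain ⟨n, hn⟩ := mem_Omega.1 hyΩ
  exact key n y hy hn

end NormedSpace

section Plane

variable {ℓ lam : ℝ}

lemma mem_omegaSeq_one_plane (hlam : 0 < lam) {x : EuclideanSpace ℝ (Fin 2)} :
    x ∈ OmegaSeq 0 (EuclideanSpace.single 0 ℓ) lam 1 ↔
      lam ^ 2 * (x 0 ^ 2 + x 1 ^ 2) < (x 0 - ℓ) ^ 2 + x 1 ^ 2 := by
  rw [mem_omegaSeq_one, ENNReal.ofReal_lt_ofReal_iff', EuclideanSpace.dist_eq,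
    EuclideanSpace.dist_eq]
  have h0 : 0 ≤ lam * √(x 0 ^ 2 + x 1 ^ 2) := by positivity
  have e : lam ^ 2 * (x 0 ^ 2 + x 1 ^ 2) = (lam * √(x 0 ^ 2 + x 1 ^ 2)) ^ 2 := by
    rw [mul_pow, Real.sq_sqrt (by positivity)]
  simp only [Fin.sum_univ_two, Real.dist_eq, sq_abs]
  simp only [PiLp.zero_apply, sub_zero, PiLp.single_apply, one_ne_zero, if_true, if_false]
  rw [e, Real.lt_sqrt h0]
  refine ⟨fun h => h.1, fun h => ⟨h, ?_⟩⟩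
  exact h0.trans_lt ((Real.lt_sqrt h0).2 h)

lemma isOpen_omegaSeq_one_plane (hlam : 0 < lam) :
    IsOpen (OmegaSeq (0 : EuclideanSpace ℝ (Fin 2)) (EuclideanSpace.single 0 ℓ) lam 1) := by
  have : OmegaSeq (0 : EuclideanSpace ℝ (Fin 2)) (EuclideanSpace.single 0 ℓ) lam 1 =
      {x | lam ^ 2 * (x 0 ^ 2 + x 1 ^ 2) < (x 0 - ℓ) ^ 2 + x 1 ^ 2} :=
    Set.ext fun x => mem_omegaSeq_one_plane hlam
  rw [this]
  exact isOpen_lt (by fun_prop) (by fun_prop)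

/-- Points of the closed right half-plane outside the Apollonius disk see `q`. -/
lemma segment_avoids_of_nonneg (hℓ : 0 < ℓ) (hlam : 1 < lam) {x : EuclideanSpace ℝ (Fin 2)}
    (h0 : 0 ≤ x 0) (hx : x ∉ OmegaSeq 0 (EuclideanSpace.single 0 ℓ) lam 1) :
    ∀ y ∈ segment ℝ x (EuclideanSpace.single 0 ℓ),
      y ∉ OmegaSeq 0 (EuclideanSpace.single 0 ℓ) lam 1 := by
  rintro y ⟨a, b, ha, hb, hab, rfl⟩
  rw [mem_omegaSeq_one_plane (by linarith)] at hx ⊢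
  simp only [PiLp.add_apply, PiLp.smul_apply, PiLp.single_apply, smul_eq_mul, one_ne_zero,
    if_true, if_false, mul_zero, add_zero]
  obtain rfl : b = 1 - a := by linarith
  have hq : 0 ≤ lam ^ 2 * (1 - a) * ℓ * ((1 - a) * ℓ + 2 * a * x 0) := by positivity
  nlinarith [mul_nonneg (sq_nonneg a) (sub_nonneg.2 (not_lt.1 hx))]

/-- A point of the Apollonius circle that sees `q` lies in the closed right half-plane. -/
lemma nonneg_of_segment_avoids (hℓ : 0 < ℓ) (hlam : 1 < lam) {x : EuclideanSpace ℝ (Fin 2)}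
    (hx : lam ^ 2 * (x 0 ^ 2 + x 1 ^ 2) = (x 0 - ℓ) ^ 2 + x 1 ^ 2)
    (hseg : ∀ y ∈ segment ℝ x (EuclideanSpace.single 0 ℓ),
      y ∉ OmegaSeq 0 (EuclideanSpace.single 0 ℓ) lam 1) : 0 ≤ x 0 := by
  by_contra! h0
  obtain ⟨a, ha0, ha1, ha⟩ : ∃ a : ℝ, 0 < a ∧ a < 1 ∧ (1 - a) * ℓ + 2 * a * x 0 < 0 :=
    ⟨(ℓ - x 0) / (ℓ - 2 * x 0), by apply div_pos <;> linarith,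
      by rw [div_lt_one] <;> linarith, by
        have hd : 0 < ℓ - 2 * x 0 := by linarith
        have hc := div_mul_cancel₀ (ℓ - x 0) hd.ne'
        linear_combination h0 - hc⟩
  refine hseg (a • x + (1 - a) • EuclideanSpace.single 0 ℓ)
    ⟨a, 1 - a, ha0.le, by linarith, by ring, rfl⟩ ?_
  rw [mem_omegaSeq_one_plane (by linarith)]
  simp only [PiLp.add_apply, PiLp.smul_apply, PiLp.single_apply, smul_eq_mul, one_ne_zero,
    if_true, if_false, mul_zero, add_zero]
  have h1 : 0 < lam ^ 2 * (1 - a) * ℓ := mul_pos (mul_pos (by positivity) (by linarith)) hℓ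
  linear_combination mul_neg_of_pos_of_neg h1 ha + a ^ 2 * hx

lemma dist_single_eq_iff (hlam : 0 < lam) {x : EuclideanSpace ℝ (Fin 2)} :
    dist x (EuclideanSpace.single 0 ℓ) = lam * dist x 0 ↔
      lam ^ 2 * (x 0 ^ 2 + x 1 ^ 2) = (x 0 - ℓ) ^ 2 + x 1 ^ 2 := by
  rw [← sq_eq_sq₀ dist_nonneg (by positivity), mul_pow, EuclideanSpace.dist_eq,
    EuclideanSpace.dist_eq, Real.sq_sqrt (by positivity), Real.sq_sqrt (by positivity)]
  simp [Fin.sum_univ_two, Real.dist_eq, sq_abs, eq_comm]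

/-- The Apollonius circle lies in the closure of the Apollonius disk. -/
lemma mem_closure_omegaSeq_one (hℓ : 0 < ℓ) (hlam : 1 < lam) {x : EuclideanSpace ℝ (Fin 2)}
    (hx : lam ^ 2 * (x 0 ^ 2 + x 1 ^ 2) = (x 0 - ℓ) ^ 2 + x 1 ^ 2) :
    x ∈ closure (OmegaSeq 0 (EuclideanSpace.single 0 ℓ) lam 1) := by
  have hsub : openSegment ℝ x 0 ⊆ OmegaSeq 0 (EuclideanSpace.single 0 ℓ) lam 1 := by
    rintro y ⟨a, b, ha, hb, hab, rfl⟩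
    rw [mem_omegaSeq_one_plane (by linarith)]
    simp only [smul_zero, add_zero, PiLp.smul_apply, smul_eq_mul]
    obtain rfl : b = 1 - a := by linarith
    have h1 : 0 ≤ a * (1 - a) * ((lam ^ 2 - 1) * (x 0 ^ 2 + x 1 ^ 2)) := by
      have : 0 ≤ lam ^ 2 - 1 := by nlinarith
      positivity
    have h2 : 0 < (1 - a) * ℓ ^ 2 := by positivity
    linear_combination h1 + h2 + a * hx
  refine closure_mono hsub ?_
  rw [closure_openSegment]
  exact left_mem_segment ℝ x 0

end Plane

/-- remark at the end of Section 3, Euclidean case.  For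
the growth competition on the Euclidean plane `ℝ²` with `p = (0,0)`,
`q = (ℓ,0)` (`ℓ > 0`) and `λ > 1`, the visibility angle equals `a = π/2`:
a boundary point `x ∈ ∂Ω` is visible (the straight segment `[q,x]` does not
meet `Ω`) if and only if `x` lies in the closed right half-plane
`{x₁ ≥ 0}`; moreover `∂Ω ∩ {x₁ ≥ 0} = ∂Ω_1 ∩ {x₁ ≥ 0}`, and this set is an
arc of the Apollonius circle `{y : |y − q| = λ |y|}`. -/
theorem euclidean_plane_visibility
    (ℓ lam : ℝ) (hℓ : 0 < ℓ) (hlam : 1 < lam)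
    (p q : EuclideanSpace ℝ (Fin 2)) (hp : p = 0)
    (hq : q = EuclideanSpace.single 0 ℓ) :
    (∀ x ∈ frontier (Omega p q lam),
      ((∀ y ∈ segment ℝ q x, y ∉ Omega p q lam) ↔ 0 ≤ x 0)) ∧
    (frontier (Omega p q lam) ∩ {x | 0 ≤ x 0} =
      frontier (OmegaSeq p q lam 1) ∩ {x | 0 ≤ x 0}) ∧
    (∀ x ∈ frontier (Omega p q lam) ∩ {x | 0 ≤ x 0},
      dist x q = lam * ‖x‖) := by
  subst hp hq
  have hl : 0 < lam := by linarith
  set q : EuclideanSpace ℝ (Fin 2) := EuclideanSpace.single 0 ℓ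
  have hopen : IsOpen (OmegaSeq 0 q lam 1) := isOpen_omegaSeq_one_plane hl
  have hsub : OmegaSeq 0 q lam 1 ⊆ Omega 0 q lam := fun x hx => mem_Omega.2 ⟨1, hx⟩
  have hnot : ∀ x ∈ frontier (Omega 0 q lam), x ∉ OmegaSeq 0 q lam 1 := fun x hx h =>
    hx.2 (interior_mono hsub (hopen.interior_eq.symm ▸ h))
  have heq : ∀ x ∈ frontier (Omega 0 q lam), (∀ y ∈ segment ℝ x q, y ∉ OmegaSeq 0 q lam 1) →
      dist x q = lam * dist x 0 := by
    intro x hx hseg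
    refine le_antisymm (not_lt.1 fun h => hnot x hx ?_)
      (not_lt.1 fun h => not_mem_closure_Omega hl hseg h hx.1)
    exact mem_omegaSeq_one.2 (ENNReal.ofReal_lt_ofReal_iff'.2
      ⟨h, (mul_nonneg hl.le dist_nonneg).trans_lt h⟩)
  have hright : ∀ x ∈ frontier (Omega 0 q lam), 0 ≤ x 0 →
      ∀ y ∈ segment ℝ x q, y ∉ OmegaSeq 0 q lam 1 := fun x hx h0 =>
    segment_avoids_of_nonneg hℓ hlam h0 (hnot x hx)
  refine ⟨fun x hx => ?_, ?_, ?_⟩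
  · rw [segment_symm]
    refine ⟨fun h => ?_, fun h0 y hy => not_mem_Omega_of_segment fun z hz => ?_⟩
    · have hseg : ∀ y ∈ segment ℝ x q, y ∉ OmegaSeq 0 q lam 1 := fun y hy hy1 => h y hy (hsub hy1)
      exact nonneg_of_segment_avoids hℓ hlam ((dist_single_eq_iff hl).1 (heq x hx hseg)) hseg
    · exact hright x hx h0 z
        ((convex_segment x q).segment_subset hy (right_mem_segment ℝ x q) hz)
  · ext x
    refine ⟨fun ⟨hx, h0⟩ => ⟨⟨?_, ?_⟩, h0⟩, fun ⟨hx, h0⟩ => ⟨⟨closure_mono hsub hx.1, ?_⟩, h0⟩⟩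
    · exact mem_closure_omegaSeq_one hℓ hlam
        ((dist_single_eq_iff hl).1 (heq x hx (hright x hx h0)))
    · exact fun h => hnot x hx (interior_subset h)
    · rw [hopen.frontier_eq] at hx
      exact fun h => not_mem_Omega_of_segment (segment_avoids_of_nonneg hℓ hlam h0 hx.2)
        (interior_subset h)
  · rintro x ⟨hx, h0⟩
    rw [heq x hx (hright x hx h0), dist_zero_right]

end GrowthComp
end
end
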